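/- arXiv:2105.13159 — 3 statements merged into one kernel-verified Lean document; each statement's English description precedes it below -/
import Mathlib

section
/- For the metric bounded-confidence vector field f^m, the set of Krasovsky solutions of ẋ = f^m(x) coincides with the set of Filippov solutions of ẋ = f^m(x). -/
open MeasureTheory Set Filter
open scoped Pointwise

noncomputable section

/-- The state space of `N` agents with opinions in `ℝ^n`. -/
abbrev St (n N : ℕ) := Fin N → EuclideanSpace ℝ (Fin n)

/-- The Krasovsky multifunction of a vector field `g`:
`K g (x) = ⋂_{δ>0} closure (convexHull (g '' B(x,δ)))`. -/
def krasovsky {E : Type*} [NormedAddCommGroup E] [NormedSpace ℝ E] (g : E → E) (x : E) :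
    Set E :=
  ⋂ δ > (0:ℝ), closure (convexHull ℝ (g '' Metric.ball x δ))

/-- The Filippov multifunction of a vector field `g`:
`F g (x) = ⋂_{δ>0} ⋂_{S null} closure (convexHull (g '' (B(x,δ) \ S)))`. -/
def filippov {E : Type*} [NormedAddCommGroup E] [NormedSpace ℝ E] [MeasureSpace E]
    (g : E → E) (x : E) : Set E :=
  ⋂ δ > (0:ℝ), ⋂ S ∈ {S : Set E | volume S = 0},
    closure (convexHull ℝ (g '' (Metric.ball x δ \ S)))

/-- Krasovsky solution of `ẋ = g(x)` on the set `D`: an absolutely continuous curve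
(written in integral form) whose a.e. derivative `v` satisfies `v(s) ∈ K g (x(s))`. -/
def IsKrasovskySolutionOn {E : Type*} [NormedAddCommGroup E] [NormedSpace ℝ E]
    [CompleteSpace E] (g : E → E) (x : ℝ → E) (D : Set ℝ) : Prop :=
  ∃ v : ℝ → E, LocallyIntegrableOn v D ∧
    (∀ t ∈ D, x t = x 0 + ∫ s in Ioc (0:ℝ) t, v s) ∧
    (∀ᵐ s ∂(volume.restrict D), v s ∈ krasovsky g (x s))

/-- Filippov solution of `ẋ = g(x)` on the set `D`: an absolutely continuous curve
(written in integral form) whose a.e. derivative `v` satisfies `v(s) ∈ F g (x(s))`. -/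
def IsFilippovSolutionOn {E : Type*} [NormedAddCommGroup E] [NormedSpace ℝ E]
    [CompleteSpace E] [MeasureSpace E] (g : E → E) (x : ℝ → E) (D : Set ℝ) : Prop :=
  ∃ v : ℝ → E, LocallyIntegrableOn v D ∧
    (∀ t ∈ D, x t = x 0 + ∫ s in Ioc (0:ℝ) t, v s) ∧
    (∀ᵐ s ∂(volume.restrict D), v s ∈ filippov g (x s))

/-- The metric bounded-confidence vector field:
`fᵐᵢ(x) = Σ_{j : ‖x_j - x_i‖ < 1} a(‖x_j - x_i‖)(x_j - x_i)`. -/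
def fm {n N : ℕ} (a : ℝ → ℝ) (x : St n N) : St n N :=
  fun i => ∑ j ∈ Finset.univ.filter (fun j => ‖x j - x i‖ < 1),
    a ‖x j - x i‖ • (x j - x i)

/-- The Filippov multifunction is contained in the Krasovsky multifunction. -/
theorem filippov_subset_krasovsky {E : Type*} [NormedAddCommGroup E] [NormedSpace ℝ E]
    [MeasureSpace E] (g : E → E) (x : E) : filippov g x ⊆ krasovsky g x := by
  intro v hv
  simp only [filippov, krasovsky, mem_iInter] at hv ⊢
  intro δ hδ
  simpa using hv δ hδ ∅ measure_empty

/-- If every value of `g` on a ball is a limit of values of `g` off any given null set in that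
ball, then the Krasovsky multifunction is contained in the Filippov multifunction. -/
theorem krasovsky_subset_filippov {E : Type*} [NormedAddCommGroup E] [NormedSpace ℝ E]
    [MeasureSpace E] {g : E → E} {x : E}
    (h : ∀ δ > 0, ∀ S : Set E, volume S = 0 → ∀ y ∈ Metric.ball x δ,
      g y ∈ closure (g '' (Metric.ball x δ \ S))) :
    krasovsky g x ⊆ filippov g x := by
  intro v hv
  simp only [filippov, krasovsky, mem_iInter] at hv ⊢
  intro δ hδ S hS
  refine closure_minimal (convexHull_min ?_ (convex_convexHull ℝ _).closure) isClosed_closure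
    (hv δ hδ)
  rintro _ ⟨y, hy, rfl⟩
  exact closure_mono (subset_convexHull ℝ _) (h δ hδ S hS y hy)

/-- The states whose neighbour relation agrees with that of `y` and in which no two agents are at
distance exactly one. -/
def strictPattern {n N : ℕ} (y : St n N) : Set (St n N) :=
  {z | ∀ i j, (‖y j - y i‖ < 1 ∧ ‖z j - z i‖ < 1) ∨ (1 ≤ ‖y j - y i‖ ∧ 1 < ‖z j - z i‖)}

theorem isOpen_strictPattern {n N : ℕ} (y : St n N) : IsOpen (strictPattern y) := by
  simp only [strictPattern, ofPred_forall]
  refine isOpen_iInter_of_finite fun i => isOpen_iInter_of_finite fun j => ?_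
  exact (isOpen_const.and (isOpen_lt (by fun_prop) (by fun_prop))).union
    (isOpen_const.and (isOpen_lt (by fun_prop) (by fun_prop)))

/-- Small dilations `(1 + ε) y` realise the neighbour relation of `y` strictly. -/
theorem mem_closure_strictPattern {n N : ℕ} (y : St n N) : y ∈ closure (strictPattern y) := by
  have hlim : Tendsto (fun c : ℝ => c • y) (nhdsWithin 1 (Ioi 1)) (nhds y) := by
    have : Continuous fun c : ℝ => c • y := by fun_prop
    simpa using (this.tendsto 1).mono_left nhdsWithin_le_nhds
  refine mem_closure_of_tendsto hlim ?_
  simp only [strictPattern, mem_ofPred_eq, eventually_all]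
  intro i j
  have hnorm : ∀ c : ℝ, 1 < c → ‖(c • y) j - (c • y) i‖ = c * ‖y j - y i‖ := by
    intro c hc
    rw [Pi.smul_apply, Pi.smul_apply, ← smul_sub, norm_smul, Real.norm_of_nonneg (by linarith)]
  rcases lt_or_ge ‖y j - y i‖ 1 with h | h
  · have hc : Continuous fun c : ℝ => c * ‖y j - y i‖ := by fun_prop
    have hlt : ∀ᶠ c in nhdsWithin (1 : ℝ) (Ioi 1), c * ‖y j - y i‖ < 1 :=
      ((hc.tendsto 1).eventually_lt_const (by simpa using h)).filter_mono nhdsWithin_le_nhds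
    filter_upwards [hlt, self_mem_nhdsWithin] with c hc1 hc2
    exact Or.inl ⟨h, by rwa [hnorm c hc2]⟩
  · filter_upwards [self_mem_nhdsWithin] with c hc
    refine Or.inr ⟨h, ?_⟩
    rw [hnorm c hc]
    rw [mem_Ioi] at hc
    nlinarith

/-- Each value of the metric field is a limit of its values off a null set. -/
theorem fm_mem_closure_image_diff {n N : ℕ} {a : ℝ → ℝ} (ha : ContinuousOn a (Ici 0))
    {B S : Set (St n N)} (hB : IsOpen B) (hS : volume S = 0) {y : St n N} (hy : y ∈ B) :
    fm a y ∈ closure (fm a '' (B \ S)) := by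
  let g : St n N → St n N := fun z i =>
    ∑ j ∈ Finset.univ.filter (fun j => ‖y j - y i‖ < 1), a ‖z j - z i‖ • (z j - z i)
  have hg : Continuous g := by
    refine continuous_pi fun i => continuous_finsetSum _ fun j _ => ?_
    have hw : Continuous fun z : St n N => a ‖z j - z i‖ :=
      ha.comp_continuous (by fun_prop) fun z => norm_nonneg _
    exact hw.smul (by fun_prop)
  have hfg : ∀ z ∈ strictPattern y, g z = fm a z := by
    intro z hz
    funext i
    refine Finset.sum_congr (Finset.filter_congr fun j _ => ?_) fun _ _ => rfl
    rcases hz i j with h | h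
    · exact iff_of_true h.1 h.2
    · exact iff_of_false h.1.not_gt h.2.not_gt
  have hdense : Dense Sᶜ := Measure.dense_of_ae (measure_eq_zero_iff_ae_notMem.1 hS)
  have hy' : y ∈ closure ((B ∩ strictPattern y) ∩ Sᶜ) :=
    closure_minimal (hdense.open_subset_closure_inter (hB.inter (isOpen_strictPattern y)))
      isClosed_closure (hB.inter_closure ⟨hy, mem_closure_strictPattern y⟩)
  refine closure_mono ?_ (image_closure_subset_closure_image hg (mem_image_of_mem g hy'))
  rintro _ ⟨z, ⟨⟨hzB, hzU⟩, hzS⟩, rfl⟩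
  exact ⟨z, ⟨hzB, hzS⟩, (hfg z hzU).symm⟩

/-- For the metric field with continuous weight, the two multifunctions agree pointwise. -/
theorem krasovsky_fm_eq_filippov_fm {n N : ℕ} {a : ℝ → ℝ} (ha : ContinuousOn a (Ici 0))
    (x : St n N) : krasovsky (fm a) x = filippov (fm a) x :=
  (krasovsky_subset_filippov fun _ _ _ hS _ hy =>
    fm_mem_closure_image_diff ha Metric.isOpen_ball hS hy).antisymm
    (filippov_subset_krasovsky _ _)

/-- For the metric bounded-confidence vector field, Krasovsky and Filippov solutions
coincide. -/
theorem metric_krasovsky_eq_filippov (n N : ℕ) (hn : 1 ≤ n) (hN : 1 ≤ N)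
    (a : ℝ → ℝ)
    (ha_lip : ∃ K : NNReal, LipschitzOnWith K a (Set.Ici 0))
    (ha_nonneg : ∀ r : ℝ, 0 ≤ r → 0 ≤ a r)
    (ha_pos : ∀ r : ℝ, 0 < r → 0 < a r)
    (ha_mono : MonotoneOn a (Set.Ici 0))
    :
    ∀ (x : ℝ → St n N) (D : Set ℝ),
      IsKrasovskySolutionOn (fm a) x D ↔ IsFilippovSolutionOn (fm a) x D := by
  obtain ⟨K, hK⟩ := ha_lip
  intro x D
  simp only [IsKrasovskySolutionOn, IsFilippovSolutionOn,
    krasovsky_fm_eq_filippov_fm hK.continuousOn]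
end
end

section
/- Let x(·) = (x_1(·),…,x_N(·)) be a Krasovsky solution of the metric bounded-confidence model ẋ = f^m(x), where a : [0,∞) → [0,∞) is continuous, nondecreasing and positive on (0,∞). Then for all 0 ≤ T¹ < T², the closed convex hull of {x_1(T²),…,x_N(T²)} is contained in the closed convex hull of {x_1(T¹),…,x_N(T¹)}. -/
open MeasureTheory Set Filter
open scoped Pointwise

noncomputable section

/-- A function on an interval whose increments are at most quadratic in the length of the step
does not increase. -/
theorem le_of_sub_le_mul_sq {W : ℝ → ℝ} {C T₁ T₂ : ℝ} (h : T₁ ≤ T₂)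
    (hW : ∀ s t, T₁ ≤ s → s ≤ t → W t - W s ≤ C * (t - s) ^ 2) : W T₂ ≤ W T₁ := by
  have hstep : ∀ m : ℕ, W T₂ - W T₁ ≤ C * (T₂ - T₁) ^ 2 / ((m : ℝ) + 1) := by
    intro m
    have hm : (0 : ℝ) < (m : ℝ) + 1 := by positivity
    have hd : 0 ≤ (T₂ - T₁) / ((m : ℝ) + 1) := div_nonneg (sub_nonneg.2 h) hm.le
    have htel := Finset.sum_range_sub
      (fun k : ℕ => W (T₁ + k * ((T₂ - T₁) / ((m : ℝ) + 1)))) (m + 1)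
    have hsum : ∑ k ∈ Finset.range (m + 1),
        (W (T₁ + ((k + 1 : ℕ) : ℝ) * ((T₂ - T₁) / ((m : ℝ) + 1)))
          - W (T₁ + k * ((T₂ - T₁) / ((m : ℝ) + 1))))
        ≤ ∑ _k ∈ Finset.range (m + 1), C * ((T₂ - T₁) / ((m : ℝ) + 1)) ^ 2 := by
      refine Finset.sum_le_sum fun k _ => ?_
      have := hW (T₁ + k * ((T₂ - T₁) / ((m : ℝ) + 1)))
        (T₁ + ((k + 1 : ℕ) : ℝ) * ((T₂ - T₁) / ((m : ℝ) + 1)))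
        (by have := mul_nonneg (Nat.cast_nonneg (α := ℝ) k) hd; linarith)
        (by push_cast; linarith)
      refine this.trans (le_of_eq ?_)
      push_cast
      ring
    rw [htel] at hsum
    have hend : T₁ + ((m + 1 : ℕ) : ℝ) * ((T₂ - T₁) / ((m : ℝ) + 1)) = T₂ := by
      push_cast; field_simp; ring
    simp only [hend, Nat.cast_zero, zero_mul, add_zero, Finset.sum_const, Finset.card_range,
      nsmul_eq_mul] at hsum
    refine hsum.trans (le_of_eq ?_)
    push_cast; field_simp
  have hlim : Tendsto (fun m : ℕ => C * (T₂ - T₁) ^ 2 / ((m : ℝ) + 1)) atTop (nhds 0) := by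
    simpa [div_eq_mul_inv] using
      (tendsto_one_div_add_atTop_nhds_zero_nat (𝕜 := ℝ)).const_mul (C * (T₂ - T₁) ^ 2)
  linarith [ge_of_tendsto' hlim hstep]

/-- The differential, up to a factor `2`, of `z ↦ ∑ i, max (ℓ (z i) - c) 0 ^ 2`. -/
def excessDeriv {n N : ℕ} (ℓ : EuclideanSpace ℝ (Fin n) →L[ℝ] ℝ) (c : ℝ) (z : St n N) :
    St n N →L[ℝ] ℝ :=
  ∑ i, max (ℓ (z i) - c) 0 • ℓ.comp (ContinuousLinearMap.proj i)

section

variable {n N : ℕ} (ℓ : EuclideanSpace ℝ (Fin n) →L[ℝ] ℝ) (c : ℝ)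

theorem excessDeriv_apply (z w : St n N) :
    excessDeriv ℓ c z w = ∑ i, max (ℓ (z i) - c) 0 * ℓ (w i) := by
  simp [excessDeriv]

theorem excess_sub_le (z z' : St n N) :
    ∑ i, max (ℓ (z' i) - c) 0 ^ 2 - ∑ i, max (ℓ (z i) - c) 0 ^ 2
      ≤ 2 * excessDeriv ℓ c z' (z' - z) := by
  rw [excessDeriv_apply, ← Finset.sum_sub_distrib, Finset.mul_sum]
  refine Finset.sum_le_sum fun i _ => ?_
  rw [Pi.sub_apply, map_sub]
  rcases le_total (ℓ (z' i) - c) 0 with h | h <;> rcases le_total (ℓ (z i) - c) 0 with h' | h' <;>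
    simp only [max_eq_left, max_eq_right, h, h'] <;> nlinarith [sq_nonneg (ℓ (z' i) - ℓ (z i))]

theorem excessDeriv_le_add (z z' w : St n N) :
    excessDeriv ℓ c z w ≤ excessDeriv ℓ c z' w + N * ‖ℓ‖ ^ 2 * ‖z - z'‖ * ‖w‖ := by
  have key : ∀ i, max (ℓ (z i) - c) 0 * ℓ (w i)
      ≤ max (ℓ (z' i) - c) 0 * ℓ (w i) + ‖ℓ‖ ^ 2 * ‖z - z'‖ * ‖w‖ := by
    intro i
    have h1 : |max (ℓ (z i) - c) 0 - max (ℓ (z' i) - c) 0| ≤ ‖ℓ‖ * ‖z - z'‖ := by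
      refine (abs_max_sub_max_le_abs _ _ _).trans ?_
      have : ℓ (z i) - c - (ℓ (z' i) - c) = ℓ ((z - z') i) := by
        rw [Pi.sub_apply, map_sub]; ring
      rw [this]
      exact (ℓ.le_opNorm _).trans
        (mul_le_mul_of_nonneg_left (norm_le_pi_norm (z - z') i) (norm_nonneg _))
    have h2 : |ℓ (w i)| ≤ ‖ℓ‖ * ‖w‖ := (ℓ.le_opNorm _).trans
        (mul_le_mul_of_nonneg_left (norm_le_pi_norm w i) (norm_nonneg _))
    have h3 := (le_abs_self _).trans ((abs_mul _ _).le.trans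
      (mul_le_mul h1 h2 (abs_nonneg _) (by positivity)))
    nlinarith
  rw [excessDeriv_apply, excessDeriv_apply]
  refine (Finset.sum_le_sum fun i _ => key i).trans (le_of_eq ?_)
  rw [Finset.sum_add_distrib]
  simp; ring

variable {a : ℝ → ℝ}

/-- By symmetry of the interaction, the field `fm a` does not increase the excess. -/
theorem excessDeriv_fm_nonpos (ha_nonneg : ∀ r : ℝ, 0 ≤ r → 0 ≤ a r) (z : St n N) :
    excessDeriv ℓ c z (fm a z) ≤ 0 := by
  set w : Fin N → Fin N → ℝ := fun i j => if ‖z j - z i‖ < 1 then a ‖z j - z i‖ else 0 with hw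
  have hw0 : ∀ i j, 0 ≤ w i j := fun i j => by
    simp only [hw]; split_ifs
    · exact ha_nonneg _ (norm_nonneg _)
    · exact le_rfl
  have hsymm : ∀ i j, w i j = w j i := fun i j => by simp only [hw, norm_sub_rev]
  have hS : excessDeriv ℓ c z (fm a z)
      = ∑ i, ∑ j, max (ℓ (z i) - c) 0 * (w i j * (ℓ (z j) - ℓ (z i))) := by
    rw [excessDeriv_apply]
    refine Finset.sum_congr rfl fun i _ => ?_
    rw [← Finset.mul_sum, fm, map_sum, Finset.sum_filter]
    congr 1
    refine Finset.sum_congr rfl fun j _ => ?_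
    simp only [hw]
    split_ifs <;> simp
  have hS' : excessDeriv ℓ c z (fm a z)
      = ∑ i, ∑ j, max (ℓ (z j) - c) 0 * (w i j * (ℓ (z i) - ℓ (z j))) := by
    rw [hS, Finset.sum_comm]
    exact Finset.sum_congr rfl fun i _ => Finset.sum_congr rfl fun j _ => by rw [hsymm]
  have h2 : excessDeriv ℓ c z (fm a z) + excessDeriv ℓ c z (fm a z) ≤ 0 := by
    nth_rewrite 1 [hS]
    rw [hS', ← Finset.sum_add_distrib]
    refine Finset.sum_nonpos fun i _ => ?_
    rw [← Finset.sum_add_distrib]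
    refine Finset.sum_nonpos fun j _ => ?_
    have h : 0 ≤ (max (ℓ (z i) - c) 0 - max (ℓ (z j) - c) 0) * (ℓ (z i) - ℓ (z j)) := by
      rcases le_total (ℓ (z i)) (ℓ (z j)) with h | h
      · exact mul_nonneg_of_nonpos_of_nonpos
          (sub_nonpos.2 (max_le_max (by linarith) le_rfl)) (by linarith)
      · exact mul_nonneg
          (sub_nonneg.2 (max_le_max (by linarith) le_rfl)) (by linarith)
    nlinarith [mul_nonneg (hw0 i j) h]
  linarith

theorem norm_fm_le (ha_nonneg : ∀ r : ℝ, 0 ≤ r → 0 ≤ a r) (ha_mono : MonotoneOn a (Set.Ici 0))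
    (z : St n N) : ‖fm a z‖ ≤ N * a 1 := by
  have h1 : 0 ≤ a 1 := ha_nonneg 1 zero_le_one
  refine (pi_norm_le_iff_of_nonneg (by positivity)).2 fun i => ?_
  rw [fm, Finset.sum_filter]
  refine (norm_sum_le_of_le (f := _) (n := fun _ => a 1) _ fun j _ => ?_).trans (by simp)
  split_ifs with h
  · rw [norm_smul, Real.norm_of_nonneg (ha_nonneg _ (norm_nonneg _))]
    simpa using mul_le_mul (ha_mono (norm_nonneg _) (mem_Ici.2 zero_le_one) h.le) h.le
      (norm_nonneg _) h1
  · simpa using h1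

end

/-- Elements of the Krasovsky set belong to every closed convex set containing the nearby values
of the field. -/
theorem krasovsky_subset {E : Type*} [NormedAddCommGroup E] [NormedSpace ℝ E] {g : E → E} {z : E}
    {S : Set E} {δ : ℝ} (hδ : 0 < δ) (hc : Convex ℝ S) (hcl : IsClosed S)
    (h : ∀ y ∈ Metric.ball z δ, g y ∈ S) : krasovsky g z ⊆ S := fun _ hv =>
  closure_minimal (convexHull_min (image_subset_iff.2 h) hc) hcl (mem_iInter₂.1 hv δ hδ)

section

variable {n N : ℕ} {a : ℝ → ℝ}

theorem norm_le_of_mem_krasovsky_fm (ha_nonneg : ∀ r : ℝ, 0 ≤ r → 0 ≤ a r)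
    (ha_mono : MonotoneOn a (Set.Ici 0)) {z v : St n N} (hv : v ∈ krasovsky (fm a) z) :
    ‖v‖ ≤ N * a 1 := by
  have := krasovsky_subset (S := Metric.closedBall 0 (N * a 1)) one_pos (convex_closedBall _ _)
    Metric.isClosed_closedBall
    (fun y _ => mem_closedBall_zero_iff.2 (norm_fm_le ha_nonneg ha_mono y)) hv
  exact mem_closedBall_zero_iff.1 this

theorem excessDeriv_nonpos_of_mem_krasovsky_fm (ℓ : EuclideanSpace ℝ (Fin n) →L[ℝ] ℝ) (c : ℝ)
    (ha_nonneg : ∀ r : ℝ, 0 ≤ r → 0 ≤ a r) (ha_mono : MonotoneOn a (Set.Ici 0))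
    {z v : St n N} (hv : v ∈ krasovsky (fm a) z) : excessDeriv ℓ c z v ≤ 0 := by
  have h1 : 0 ≤ a 1 := ha_nonneg 1 zero_le_one
  set K : ℝ := N * ‖ℓ‖ ^ 2 * (N * a 1) with hK
  have hK0 : 0 ≤ K := by positivity
  refine le_of_forall_pos_le_add fun ε hε => ?_
  rw [zero_add]
  refine krasovsky_subset (S := {w | excessDeriv ℓ c z w ≤ ε}) (δ := ε / (K + 1)) (by positivity)
    (convex_halfSpace_le (excessDeriv ℓ c z).isLinear ε)
    (isClosed_le (excessDeriv ℓ c z).continuous continuous_const) (fun y hy => ?_) hv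
  have hd : ‖z - y‖ ≤ ε / (K + 1) := by
    rw [← dist_eq_norm, dist_comm]; exact (Metric.mem_ball.1 hy).le
  calc excessDeriv ℓ c z (fm a y)
      ≤ excessDeriv ℓ c y (fm a y) + N * ‖ℓ‖ ^ 2 * ‖z - y‖ * ‖fm a y‖ :=
        excessDeriv_le_add ℓ c z y _
    _ ≤ 0 + N * ‖ℓ‖ ^ 2 * (ε / (K + 1)) * (N * a 1) := by
        gcongr
        · exact excessDeriv_fm_nonpos ℓ c ha_nonneg y
        · exact norm_fm_le ha_nonneg ha_mono y
    _ = K * (ε / (K + 1)) := by rw [hK]; ring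
    _ ≤ ε := by
        rw [mul_div_assoc', div_le_iff₀ (by positivity)]
        nlinarith

/-- The total squared excess above any level `c` of a linear functional does not increase along
Krasovsky solutions. -/
theorem excess_antitone (ℓ : EuclideanSpace ℝ (Fin n) →L[ℝ] ℝ) (c : ℝ)
    (ha_nonneg : ∀ r : ℝ, 0 ≤ r → 0 ≤ a r) (ha_mono : MonotoneOn a (Set.Ici 0))
    {x : ℝ → St n N} (hx : IsKrasovskySolutionOn (fm a) x (Set.Ici 0)) {T₁ T₂ : ℝ}
    (hT₁ : 0 ≤ T₁) (hT : T₁ ≤ T₂) :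
    ∑ i, max (ℓ (x T₂ i) - c) 0 ^ 2 ≤ ∑ i, max (ℓ (x T₁ i) - c) 0 ^ 2 := by
  obtain ⟨v, hint, hxv, hv⟩ := hx
  have h1 : 0 ≤ a 1 := ha_nonneg 1 zero_le_one
  set M : ℝ := N * a 1 with hM
  have hM0 : 0 ≤ M := by positivity
  have hii : ∀ s t, 0 ≤ s → s ≤ t → IntervalIntegrable v volume s t := fun s t hs hst => by
    rw [intervalIntegrable_iff_integrableOn_Icc_of_le hst]
    exact hint.integrableOn_compact_subset (fun r hr => hs.trans hr.1) isCompact_Icc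
  have hsub : ∀ s t, 0 ≤ s → s ≤ t → x t - x s = ∫ r in s..t, v r := fun s t hs hst => by
    rw [hxv t (hs.trans hst), hxv s hs, ← intervalIntegral.integral_of_le hs,
      ← intervalIntegral.integral_of_le (hs.trans hst), add_sub_add_left_eq_sub]
    exact intervalIntegral.integral_interval_sub_left (hii 0 t le_rfl (hs.trans hst))
      (hii 0 s le_rfl hs)
  have hae : ∀ s t, 0 ≤ s → ∀ᵐ r, r ∈ Ioc s t → v r ∈ krasovsky (fm a) (x r) := fun s t hs => by
    filter_upwards [(ae_restrict_iff' measurableSet_Ici).1 hv] with r hr hrs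
    exact hr (hs.trans hrs.1.le)
  have hlip : ∀ s t, 0 ≤ s → s ≤ t → ‖x t - x s‖ ≤ M * (t - s) := fun s t hs hst => by
    rw [hsub s t hs hst, ← abs_of_nonneg (sub_nonneg.2 hst)]
    refine intervalIntegral.norm_integral_le_of_norm_le_const_ae ?_
    rw [uIoc_of_le hst]
    filter_upwards [hae s t hs] with r hr hrs
    exact norm_le_of_mem_krasovsky_fm ha_nonneg ha_mono (hr hrs)
  refine le_of_sub_le_mul_sq (W := fun t => ∑ i, max (ℓ (x t i) - c) 0 ^ 2)
    (C := 2 * (N * ‖ℓ‖ ^ 2 * M * M)) hT fun s t hs hst => ?_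
  have hs0 := hT₁.trans hs
  have hbound : excessDeriv ℓ c (x t) (x t - x s) ≤ N * ‖ℓ‖ ^ 2 * (M * (t - s)) * M * (t - s) := by
    rw [hsub s t hs0 hst, ← ContinuousLinearMap.intervalIntegral_comp_comm _ (hii s t hs0 hst)]
    have hmono : ∫ r in s..t, excessDeriv ℓ c (x t) (v r)
        ≤ ∫ _r in s..t, N * ‖ℓ‖ ^ 2 * (M * (t - s)) * M := by
      rw [intervalIntegral.integral_of_le hst, intervalIntegral.integral_of_le hst]
      refine setIntegral_mono_on_ae
        ((excessDeriv ℓ c (x t)).integrable_comp (hii s t hs0 hst).1)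
        (integrableOn_const measure_Ioc_lt_top.ne)
        measurableSet_Ioc ?_
      filter_upwards [hae s t hs0] with r hr hrs
      have hk := hr hrs
      have h3 := excessDeriv_le_add ℓ c (x t) (x r) (v r)
      have h4 := excessDeriv_nonpos_of_mem_krasovsky_fm ℓ c ha_nonneg ha_mono hk
      have h5 : N * ‖ℓ‖ ^ 2 * ‖x t - x r‖ * ‖v r‖ ≤ N * ‖ℓ‖ ^ 2 * (M * (t - s)) * M := by
        have h6 : ‖x t - x r‖ ≤ M * (t - s) := (hlip r t (hs0.trans hrs.1.le) hrs.2).trans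
          (mul_le_mul_of_nonneg_left (by linarith [hrs.1]) hM0)
        have h7 : 0 ≤ M * (t - s) := (norm_nonneg _).trans h6
        gcongr
        exact norm_le_of_mem_krasovsky_fm ha_nonneg ha_mono hk
      linarith
    refine hmono.trans (le_of_eq ?_)
    rw [intervalIntegral.integral_const, smul_eq_mul, mul_comm]
  calc _ ≤ 2 * excessDeriv ℓ c (x t) (x t - x s) := excess_sub_le ℓ c (x s) (x t)
    _ ≤ 2 * (N * ‖ℓ‖ ^ 2 * (M * (t - s)) * M * (t - s)) := by gcongr
    _ = _ := by ring

end

/-- Contractivity of the support for Krasovsky solutions of the metric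
bounded-confidence model. -/
theorem metric_krasovsky_support_contractivity (n N : ℕ) (hn : 1 ≤ n) (hN : 1 ≤ N)
    (a : ℝ → ℝ)
    (ha_cont : ContinuousOn a (Set.Ici 0))
    (ha_nonneg : ∀ r : ℝ, 0 ≤ r → 0 ≤ a r)
    (ha_pos : ∀ r : ℝ, 0 < r → 0 < a r)
    (ha_mono : MonotoneOn a (Set.Ici 0))
    (x : ℝ → St n N)
    (hx : IsKrasovskySolutionOn (fm a) x (Set.Ici 0)) :
    ∀ T₁ T₂ : ℝ, 0 ≤ T₁ → T₁ < T₂ →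
      closure (convexHull ℝ (Set.range fun i => x T₂ i)) ⊆
        closure (convexHull ℝ (Set.range fun i => x T₁ i)) := by
  intro T₁ T₂ hT₁ hT
  refine closure_minimal (convexHull_min ?_ (convex_convexHull ℝ _).closure) isClosed_closure
  rintro _ ⟨i, rfl⟩
  by_contra hi
  obtain ⟨ℓ, u, hu, hui⟩ :=
    geometric_hahn_banach_closed_point (convex_convexHull ℝ _).closure isClosed_closure hi
  have h0 : ∑ j, max (ℓ (x T₁ j) - u) 0 ^ 2 = 0 := Finset.sum_eq_zero fun j _ => by
    have := hu (x T₁ j) (subset_closure (subset_convexHull ℝ _ ⟨j, rfl⟩))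
    rw [max_eq_right (by linarith)]; simp
  have h1 := excess_antitone ℓ u ha_nonneg ha_mono hx hT₁ hT.le
  have h2 : max (ℓ (x T₂ i) - u) 0 ^ 2 ≤ ∑ j, max (ℓ (x T₂ j) - u) 0 ^ 2 :=
    Finset.single_le_sum (f := fun j => max (ℓ (x T₂ j) - u) 0 ^ 2)
      (fun j _ => sq_nonneg _) (Finset.mem_univ i)
  have h3 : 0 < max (ℓ (x T₂ i) - u) 0 ^ 2 := by
    have : 0 < max (ℓ (x T₂ i) - u) 0 := lt_max_of_lt_left (sub_pos.2 hui)
    positivity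
  linarith
end
end

section
/- Let κ = 1 and let x(·) be a Caratheodory solution of the topological bounded-confidence model ẋ = f^t(x) on [0, +∞). Then the function t ↦ W(x(t)), where W(x) = Σ_{i=1}^N min_{j ≠ i} I(‖x_i − x_j‖) and I(r) = ∫_0^r a(s) s ds, is continuous and non-increasing on [0, +∞). -/
open MeasureTheory Set Filter
open scoped Pointwise

noncomputable section

/-- Caratheodory solution of `ẋ = f(x)` on the set `D`: an absolutely continuous curve
satisfying `x(t) = x(0) + ∫_0^t f(x(s)) ds`. -/
def IsCaratheodorySolutionOn {E : Type*} [NormedAddCommGroup E] [NormedSpace ℝ E]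
    [CompleteSpace E] (f : E → E) (x : ℝ → E) (D : Set ℝ) : Prop :=
  LocallyIntegrableOn (fun s => f (x s)) D ∧
    ∀ t ∈ D, x t = x 0 + ∫ s in Ioc (0:ℝ) t, f (x s)

/-- `gamma x i` is the smallest index `j ≠ i` minimizing `‖x j - x i‖`
(with the junk value `i` in the degenerate case `N = 1`). -/
def gamma {n N : ℕ} (x : St n N) (i : Fin N) : Fin N :=
  if h : (Finset.univ.erase i).Nonempty then
    ((Finset.univ.erase i).filter
      (fun j => ‖x j - x i‖ = (Finset.univ.erase i).inf' h fun j => ‖x j - x i‖)).min'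
      (by
        obtain ⟨j, hj, hjd⟩ := Finset.exists_mem_eq_inf' h (fun j => ‖x j - x i‖)
        exact ⟨j, Finset.mem_filter.mpr ⟨hj, hjd.symm⟩⟩)
  else i

/-- The topological bounded-confidence vector field with `κ = 1` neighbour:
`fᵗᵢ(x) = a(‖x_{Γ(i)} - x_i‖)(x_{Γ(i)} - x_i)`. -/
def ft1 {n N : ℕ} (a : ℝ → ℝ) (x : St n N) : St n N :=
  fun i => a ‖x (gamma x i) - x i‖ • (x (gamma x i) - x i)

/-- `Ifun a r = ∫_0^r a(s) s ds`. -/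
def Ifun (a : ℝ → ℝ) (r : ℝ) : ℝ := ∫ s in (0:ℝ)..r, a s * s

/-- The Lyapunov function `W(x) = Σ_i min_{j ≠ i} I(‖x_i - x_j‖)`. -/
def Wfun {n N : ℕ} (a : ℝ → ℝ) (x : St n N) : ℝ :=
  ∑ i, ⨅ j : {j : Fin N // j ≠ i}, Ifun a ‖x i - x (j : Fin N)‖

variable {n N : ℕ} {a : ℝ → ℝ}

theorem gamma_spec (hN : 2 ≤ N) (y : St n N) (i : Fin N) :
    gamma y i ≠ i ∧ ∀ j, j ≠ i → ‖y (gamma y i) - y i‖ ≤ ‖y j - y i‖ := by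
  have : Nontrivial (Fin N) := Fin.nontrivial_iff_two_le.2 hN
  obtain ⟨j₀, hj₀⟩ := exists_ne i
  have h : (Finset.univ.erase i).Nonempty := ⟨j₀, by simp [hj₀]⟩
  have key : gamma y i ∈ (Finset.univ.erase i).filter
      (fun j => ‖y j - y i‖ = (Finset.univ.erase i).inf' h fun j => ‖y j - y i‖) := by
    rw [gamma, dif_pos h]
    exact Finset.min'_mem _ _
  rw [Finset.mem_filter] at key
  refine ⟨Finset.ne_of_mem_erase key.1, fun j hj => ?_⟩
  rw [key.2]
  exact Finset.inf'_le _ (by simp [hj])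

theorem continuous_comp_abs (ha : ContinuousOn a (Ici 0)) : Continuous fun s => a |s| :=
  ha.comp_continuous continuous_abs fun s => abs_nonneg s

theorem Ifun_eq_integral_abs {r : ℝ} (hr : 0 ≤ r) : Ifun a r = ∫ s in (0:ℝ)..r, a |s| * s := by
  refine intervalIntegral.integral_congr fun s hs => ?_
  rw [uIcc_of_le hr] at hs
  simp [abs_of_nonneg hs.1]

theorem Ifun_sub_Ifun (ha : ContinuousOn a (Ici 0)) {r s : ℝ} (hr : 0 ≤ r) (hs : 0 ≤ s) :
    Ifun a s - Ifun a r = ∫ u in r..s, a |u| * u := by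
  have hc : Continuous fun s => a |s| * s := (continuous_comp_abs ha).mul continuous_id
  rw [Ifun_eq_integral_abs hr, Ifun_eq_integral_abs hs]
  exact intervalIntegral.integral_interval_sub_left (hc.intervalIntegrable _ _)
    (hc.intervalIntegrable _ _)

theorem Ifun_monotoneOn (ha : ContinuousOn a (Ici 0)) (ha_nonneg : ∀ r : ℝ, 0 ≤ r → 0 ≤ a r) :
    MonotoneOn (Ifun a) (Ici 0) := by
  intro r hr s hs hrs
  rw [← sub_nonneg, Ifun_sub_Ifun ha hr hs]
  exact intervalIntegral.integral_nonneg hrs fun u hu =>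
    mul_nonneg (ha_nonneg _ (abs_nonneg u)) (le_trans hr hu.1)

theorem Ifun_sub_le (ha : ContinuousOn a (Ici 0)) (ha_nonneg : ∀ r : ℝ, 0 ≤ r → 0 ≤ a r)
    (ha_mono : MonotoneOn a (Ici 0)) {R r s : ℝ} (hr : r ∈ Icc 0 R) (hs : s ∈ Icc 0 R) :
    Ifun a s - Ifun a r ≤ a R * R * |s - r| := by
  rw [Ifun_sub_Ifun ha hr.1 hs.1]
  refine (Real.le_norm_self _).trans
    (intervalIntegral.norm_integral_le_of_norm_le_const fun u hu => ?_)
  have hu' : u ∈ Icc 0 R := uIcc_subset_Icc hr hs (uIoc_subset_uIcc hu)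
  rw [abs_of_nonneg hu'.1, norm_mul, Real.norm_of_nonneg (ha_nonneg _ hu'.1),
    Real.norm_of_nonneg hu'.1]
  have h0 : (0:ℝ) ≤ R := hu'.1.trans hu'.2
  exact mul_le_mul (ha_mono hu'.1 h0 hu'.2) hu'.2 hu'.1 (ha_nonneg _ h0)

theorem Ifun_eq_integral_sqrt (ha : ContinuousOn a (Ici 0)) {r : ℝ} (hr : 0 ≤ r) :
    Ifun a r = ∫ v in (0:ℝ)..r ^ 2, a √v / 2 := by
  have hc : Continuous fun v => a √v / 2 :=
    (ha.comp_continuous Real.continuous_sqrt fun v => Real.sqrt_nonneg v).div_const 2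
  have := intervalIntegral.integral_comp_mul_deriv (a := 0) (b := r) (f := fun s => s ^ 2)
    (f' := fun s => 2 * s) (g := fun v => a √v / 2)
    (fun s _ => by simpa using hasDerivAt_pow 2 s) (by fun_prop) hc
  simp only [Function.comp_def, Real.sqrt_sq_eq_abs] at this
  rw [zero_pow two_ne_zero] at this
  rw [← this, Ifun_eq_integral_abs hr]
  exact intervalIntegral.integral_congr fun s _ => by ring

theorem hasDerivAt_Ifun_norm {E : Type*} [NormedAddCommGroup E] [InnerProductSpace ℝ E]
    (ha : ContinuousOn a (Ici 0)) {u : ℝ → E} {u' : E} {t : ℝ} (hu : HasDerivAt u u' t) :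
    HasDerivAt (fun s => Ifun a ‖u s‖) (a ‖u t‖ * inner ℝ (u t) u') t := by
  have hc : Continuous fun v => a √v / 2 :=
    (ha.comp_continuous Real.continuous_sqrt fun v => Real.sqrt_nonneg v).div_const 2
  simp only [fun s => Ifun_eq_integral_sqrt ha (norm_nonneg (u s))]
  have h := (hc.integral_hasStrictDerivAt 0 (‖u t‖ ^ 2)).hasDerivAt.comp t hu.norm_sq
  rw [Real.sqrt_sq (norm_nonneg _)] at h
  exact h.congr_deriv (by ring)

theorem Wfun_le (y : St n N) {σ : Fin N → Fin N} (hσ : ∀ i, σ i ≠ i) :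
    Wfun a y ≤ ∑ i, Ifun a ‖y i - y (σ i)‖ :=
  Finset.sum_le_sum fun i _ => ciInf_le (finite_range _).bddBelow (⟨σ i, hσ i⟩ : {j // j ≠ i})

theorem Wfun_eq (hN : 2 ≤ N) (ha : ContinuousOn a (Ici 0))
    (ha_nonneg : ∀ r : ℝ, 0 ≤ r → 0 ≤ a r) (y : St n N) :
    Wfun a y = ∑ i, Ifun a ‖y i - y (gamma y i)‖ := by
  refine (Wfun_le y fun i => (gamma_spec hN y i).1).antisymm
    (Finset.sum_le_sum fun i _ => ?_)
  have : Nonempty {j // j ≠ i} := ⟨⟨_, (gamma_spec hN y i).1⟩⟩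
  refine le_ciInf fun j => Ifun_monotoneOn ha ha_nonneg (norm_nonneg _) (norm_nonneg _) ?_
  rw [norm_sub_rev, norm_sub_rev (y i)]
  exact (gamma_spec hN y i).2 j j.2

/-- Along the vector field, the derivative of the sum defining `W` is nonpositive. -/
theorem sum_inner_ft1_nonpos (hN : 2 ≤ N) (ha_nonneg : ∀ r : ℝ, 0 ≤ r → 0 ≤ a r)
    (ha_mono : MonotoneOn a (Ici 0)) (y : St n N) :
    ∑ i, a ‖y i - y (gamma y i)‖ *
      inner ℝ (y i - y (gamma y i)) (ft1 a y i - ft1 a y (gamma y i)) ≤ 0 := by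
  refine Finset.sum_nonpos fun i _ => ?_
  obtain ⟨hne, hmin⟩ := gamma_spec hN y i
  have hnorm (k : Fin N) :
      ‖ft1 a y k‖ = a ‖y (gamma y k) - y k‖ * ‖y (gamma y k) - y k‖ := by
    rw [ft1, norm_smul, Real.norm_of_nonneg (ha_nonneg _ (norm_nonneg _))]
  have hle : ‖ft1 a y (gamma y i)‖ ≤ ‖ft1 a y i‖ := by
    have hd : ‖y (gamma y (gamma y i)) - y (gamma y i)‖ ≤ ‖y (gamma y i) - y i‖ := by
      rw [norm_sub_rev (y (gamma y i)) (y i)]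
      exact (gamma_spec hN y (gamma y i)).2 i hne.symm
    rw [hnorm, hnorm]
    exact mul_le_mul (ha_mono (norm_nonneg _) (norm_nonneg _) hd) hd (norm_nonneg _)
      (ha_nonneg _ (norm_nonneg _))
  have heq : a ‖y i - y (gamma y i)‖ *
      inner ℝ (y i - y (gamma y i)) (ft1 a y i - ft1 a y (gamma y i)) =
      inner ℝ (ft1 a y i) (ft1 a y (gamma y i)) - ‖ft1 a y i‖ ^ 2 := by
    rw [← real_inner_self_eq_norm_sq, ← inner_sub_right, ← real_inner_smul_left,
      ← neg_sub (ft1 a y i), inner_neg_right, ← inner_neg_left]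
    congr 1
    rw [ft1, ← smul_neg, neg_sub, norm_sub_rev]
  rw [heq, sub_nonpos, sq]
  exact (real_inner_le_norm _ _).trans (mul_le_mul_of_nonneg_left hle (norm_nonneg _))

theorem norm_ft1_le (ha_nonneg : ∀ r : ℝ, 0 ≤ r → 0 ≤ a r)
    (ha_mono : MonotoneOn a (Ici 0)) {R : ℝ} {y : St n N} (hy : ‖y‖ ≤ R) :
    ‖ft1 a y‖ ≤ a (2 * R) * (2 * R) := by
  have hR : 0 ≤ 2 * R := by linarith [norm_nonneg y]
  refine (pi_norm_le_iff_of_nonneg (mul_nonneg (ha_nonneg _ hR) hR)).2 fun i => ?_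
  have hd : ‖y (gamma y i) - y i‖ ≤ 2 * R := by
    linarith [norm_sub_le (y (gamma y i)) (y i), norm_le_pi_norm y i,
      norm_le_pi_norm y (gamma y i)]
  rw [ft1, norm_smul, Real.norm_of_nonneg (ha_nonneg _ (norm_nonneg _))]
  exact mul_le_mul (ha_mono (norm_nonneg _) hR hd) hd (norm_nonneg _) (ha_nonneg _ hR)

section Caratheodory

variable {E : Type*} [NormedAddCommGroup E] [NormedSpace ℝ E] [CompleteSpace E]
  {f : E → E} {x : ℝ → E}

theorem IsCaratheodorySolutionOn.intervalIntegrable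
    (hx : IsCaratheodorySolutionOn f x (Ici 0)) {s t : ℝ} (hs : 0 ≤ s) (ht : 0 ≤ t) :
    IntervalIntegrable (fun u => f (x u)) volume s t :=
  (hx.1.integrableOn_compact_subset (fun _ hu => (le_min hs ht).trans hu.1)
    isCompact_uIcc).intervalIntegrable

theorem IsCaratheodorySolutionOn.eq_add_integral
    (hx : IsCaratheodorySolutionOn f x (Ici 0)) {t : ℝ} (ht : 0 ≤ t) :
    x t = x 0 + ∫ u in (0:ℝ)..t, f (x u) := by
  rw [intervalIntegral.integral_of_le ht]
  exact hx.2 t ht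

theorem IsCaratheodorySolutionOn.sub_eq_integral
    (hx : IsCaratheodorySolutionOn f x (Ici 0)) {s t : ℝ} (hs : 0 ≤ s) (ht : 0 ≤ t) :
    x t - x s = ∫ u in s..t, f (x u) := by
  rw [hx.eq_add_integral hs, hx.eq_add_integral ht, add_sub_add_left_eq_sub]
  exact intervalIntegral.integral_interval_sub_left (hx.intervalIntegrable le_rfl ht)
    (hx.intervalIntegrable le_rfl hs)

theorem IsCaratheodorySolutionOn.continuousOn_Icc
    (hx : IsCaratheodorySolutionOn f x (Ici 0)) (T : ℝ) : ContinuousOn x (Icc 0 T) := by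
  have hi : IntegrableOn (fun u => f (x u)) (Icc 0 T) :=
    hx.1.integrableOn_compact_subset (fun _ hu => hu.1) isCompact_Icc
  exact ((intervalIntegral.continuousOn_primitive hi).const_add (x 0)).congr
    fun t ht => hx.2 t ht.1

theorem IsCaratheodorySolutionOn.ae_hasDerivAt
    (hx : IsCaratheodorySolutionOn f x (Ici 0)) {T : ℝ} (hT : 0 ≤ T) :
    ∀ᵐ t, t ∈ Ioo 0 T → HasDerivAt x (f (x t)) t := by
  filter_upwards [(hx.intervalIntegrable le_rfl hT).ae_hasDerivAt_integral] with t h ht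
  rw [uIcc_of_le hT] at h
  refine ((h (Ioo_subset_Icc_self ht) 0 (left_mem_Icc.2 hT)).const_add (x 0)).congr_of_eventuallyEq
    ?_
  filter_upwards [Ioi_mem_nhds ht.1] with s hs using hx.eq_add_integral (le_of_lt hs)

end Caratheodory

theorem exists_lipschitzOnWith_Wfun (hN : 2 ≤ N) (ha : ContinuousOn a (Ici 0))
    (ha_nonneg : ∀ r : ℝ, 0 ≤ r → 0 ≤ a r) (ha_mono : MonotoneOn a (Ici 0))
    {x : ℝ → St n N} (hx : IsCaratheodorySolutionOn (ft1 a) x (Ici 0)) (T : ℝ) :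
    ∃ K : NNReal, LipschitzOnWith K (fun t => Wfun a (x t)) (Icc 0 T) := by
  obtain ⟨R, hR⟩ := isCompact_Icc.exists_bound_of_continuousOn (hx.continuousOn_Icc T)
  set L : ℝ := a (2 * R) * (2 * R) with hL
  have hlip {s t : ℝ} (hs : s ∈ Icc 0 T) (ht : t ∈ Icc 0 T) : ‖x t - x s‖ ≤ L * |t - s| := by
    rw [hx.sub_eq_integral hs.1 ht.1]
    exact intervalIntegral.norm_integral_le_of_norm_le_const fun u hu =>
      norm_ft1_le ha_nonneg ha_mono (hR u (uIcc_subset_Icc hs ht (uIoc_subset_uIcc hu)))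
  have hdist {t : ℝ} (ht : t ∈ Icc 0 T) (i j : Fin N) : ‖x t i - x t j‖ ∈ Icc 0 (2 * R) := by
    refine ⟨norm_nonneg _, ?_⟩
    linarith [norm_sub_le (x t i) (x t j), norm_le_pi_norm (x t) i,
      norm_le_pi_norm (x t) j, hR t ht]
  refine ⟨(∑ _i : Fin N, L * (2 * L)).toNNReal, LipschitzOnWith.of_le_add_mul' _ ?_⟩
  intro s hs t ht
  have hL0 : 0 ≤ L := mul_nonneg (ha_nonneg _ ((hdist hs ⟨0, by omega⟩ ⟨0, by omega⟩).1.trans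
    (hdist hs _ _).2)) ((hdist hs ⟨0, by omega⟩ ⟨0, by omega⟩).1.trans (hdist hs _ _).2)
  rw [← sub_le_iff_le_add', Finset.sum_mul]
  calc Wfun a (x s) - Wfun a (x t)
      ≤ ∑ i, Ifun a ‖x s i - x s (gamma (x t) i)‖ - ∑ i, Ifun a ‖x t i - x t (gamma (x t) i)‖ := by
        rw [Wfun_eq hN ha ha_nonneg (x t)]
        exact sub_le_sub_right
          (Wfun_le (x s) fun i => (gamma_spec hN (x t) i).1) _
    _ ≤ ∑ _i : Fin N, L * (2 * L) * dist s t := by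
        rw [← Finset.sum_sub_distrib]
        refine Finset.sum_le_sum fun i _ => ?_
        set j := gamma (x t) i
        refine (Ifun_sub_le ha ha_nonneg ha_mono (hdist ht i j) (hdist hs i j)).trans ?_
        rw [← hL, mul_assoc L (2 * L)]
        refine mul_le_mul_of_nonneg_left ?_ hL0
        have h1 := (norm_le_pi_norm (x s - x t) i).trans (hlip ht hs)
        have h2 := (norm_le_pi_norm (x s - x t) j).trans (hlip ht hs)
        have h3 := norm_sub_le ((x s - x t) i) ((x s - x t) j)
        refine (abs_norm_sub_norm_le _ _).trans ?_
        rw [Real.dist_eq, show x s i - x s j - (x t i - x t j) = (x s - x t) i - (x s - x t) j by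
          simp only [Pi.sub_apply]; abel]
        linarith

theorem deriv_Wfun_nonpos (hN : 2 ≤ N) (ha : ContinuousOn a (Ici 0))
    (ha_nonneg : ∀ r : ℝ, 0 ≤ r → 0 ≤ a r) (ha_mono : MonotoneOn a (Ici 0))
    {x : ℝ → St n N} {t : ℝ} (hx : HasDerivAt x (ft1 a (x t)) t) :
    deriv (fun s => Wfun a (x s)) t ≤ 0 := by
  by_cases hd : DifferentiableAt ℝ (fun s => Wfun a (x s)) t
  · have hV : HasDerivAt (fun s => ∑ i, Ifun a ‖x s i - x s (gamma (x t) i)‖)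
        (∑ i, a ‖x t i - x t (gamma (x t) i)‖ * inner ℝ (x t i - x t (gamma (x t) i))
          (ft1 a (x t) i - ft1 a (x t) (gamma (x t) i))) t :=
      HasDerivAt.fun_sum fun i _ => hasDerivAt_Ifun_norm ha
        ((hasDerivAt_pi.1 hx i).sub (hasDerivAt_pi.1 hx (gamma (x t) i)))
    have hmax : IsLocalMax (fun s => Wfun a (x s) -
        ∑ i, Ifun a ‖x s i - x s (gamma (x t) i)‖) t := by
      refine Eventually.of_forall fun s => ?_
      simp only [← Wfun_eq hN ha ha_nonneg (x t), sub_self, sub_nonpos]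
      exact Wfun_le (x s) fun i => (gamma_spec hN (x t) i).1
    rw [sub_eq_zero.1 (hmax.hasDerivAt_eq_zero (hd.hasDerivAt.sub hV))]
    exact sum_inner_ft1_nonpos hN ha_nonneg ha_mono (x t)
  · exact (deriv_zero_of_not_differentiableAt hd).le

/-- For `κ = 1`, the function `W` is a Lyapunov function along Caratheodory solutions
of the topological bounded-confidence model. -/
theorem topological_caratheodory_W_lyapunov (n N : ℕ) (hn : 1 ≤ n) (hN : 2 ≤ N)
    (a : ℝ → ℝ)
    (ha_lip : ∃ K : NNReal, LipschitzOnWith K a (Set.Ici 0))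
    (ha_nonneg : ∀ r : ℝ, 0 ≤ r → 0 ≤ a r)
    (ha_pos : ∀ r : ℝ, 0 < r → 0 < a r)
    (ha_mono : MonotoneOn a (Set.Ici 0))
    (x : ℝ → St n N)
    (hx : IsCaratheodorySolutionOn (ft1 a) x (Set.Ici 0)) :
    ContinuousOn (fun t => Wfun a (x t)) (Set.Ici 0) ∧
      AntitoneOn (fun t => Wfun a (x t)) (Set.Ici 0) := by
  obtain ⟨K, hK⟩ := ha_lip
  have ha := hK.continuousOn
  have hlip := exists_lipschitzOnWith_Wfun hN ha ha_nonneg ha_mono hx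
  refine ⟨fun t ht => ?_, fun s hs t ht hst => ?_⟩
  · obtain ⟨K', hK'⟩ := hlip (t + 1)
    refine (hK'.continuousOn t ⟨ht, by linarith⟩).mono_of_mem_nhdsWithin ?_
    filter_upwards [self_mem_nhdsWithin, mem_nhdsWithin_of_mem_nhds (Iio_mem_nhds (lt_add_one t))]
      with u hu hu' using ⟨hu, le_of_lt hu'⟩
  · obtain ⟨K', hK'⟩ := hlip t
    have hac : AbsolutelyContinuousOnInterval (fun u => Wfun a (x u)) s t :=
      (hK'.mono (uIcc_subset_Icc ⟨hs, hst⟩ ⟨ht, le_rfl⟩)).absolutelyContinuousOnInterval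
    rw [← sub_nonpos]
    simp only [← hac.integral_deriv_eq_sub]
    rw [← neg_nonneg, ← intervalIntegral.integral_neg]
    refine intervalIntegral.integral_nonneg_of_ae_restrict hst ?_
    rw [← restrict_Ioo_eq_restrict_Icc]
    refine (ae_restrict_iff' measurableSet_Ioo).2 ?_
    filter_upwards [hx.ae_hasDerivAt ht] with u hu hut
    exact neg_nonneg.2 (deriv_Wfun_nonpos hN ha ha_nonneg ha_mono
      (hu ⟨lt_of_le_of_lt hs hut.1, hut.2⟩))
end
end
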